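/- For each nonnegative integer k there is a constant C_k > 0, depending only on k, such that for all ν ≥ 2 and all 0 < z ≤ 1, the function ν ↦ M²(ν,z) is k times differentiable and 0 ≤ (∂/∂ν)^k M²(ν,z) ≤ C_k·(ν + |log z|)^k·M²(ν,z). -/

import Mathlib

open Real MeasureTheory Set Filter

/-- Integral representation of the modified Bessel function `K₀`. -/
noncomputable def K0 (x : ℝ) : ℝ := ∫ t in Ioi (0:ℝ), Real.exp (-x * Real.cosh t)

/-- Bessel modulus squared, via Nicholson's formula. -/
noncomputable def M2 (ν z : ℝ) : ℝ :=
  (8 / π ^ 2) * ∫ t in Ioi (0:ℝ), K0 (2 * z * Real.sinh t) * Real.cosh (2 * ν * t)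

open ProbabilityTheory in
/-- The bilateral exponential moments of `X` give smoothness of `s ↦ ∫ cosh (s X)`. -/
lemma contDiff_integral_cosh {Ω : Type*} [MeasurableSpace Ω] {μ : Measure Ω} {X : Ω → ℝ}
    (h : ∀ s : ℝ, Integrable (fun ω => Real.exp (s * X ω)) μ) (k : ℕ) :
    ContDiff ℝ k (fun s => ∫ ω, Real.cosh (s * X ω) ∂μ) ∧
    ∀ s, iteratedDeriv k (fun s => ∫ ω, Real.cosh (s * X ω) ∂μ) s =
      ∫ ω, X ω ^ k * ((Real.exp (s * X ω) + (-1) ^ k * Real.exp (-s * X ω)) / 2) ∂μ := by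
  have hset : ∀ s, s ∈ interior (integrableExpSet X μ) := by
    have huniv : integrableExpSet X μ = univ := eq_univ_of_forall h
    simp [huniv]
  have hcosh : (fun s => ∫ ω, Real.cosh (s * X ω) ∂μ) =
      fun s => (1 / 2 : ℝ) * (mgf X μ s + mgf X μ (-s)) := by
    funext s
    simp only [mgf]
    rw [← integral_add (h s) (h (-s)), ← integral_const_mul]
    congr 1; funext ω
    rw [Real.cosh_eq, neg_mul]; ring
  have hmgf : ContDiff ℝ k (mgf X μ) :=
    contDiff_iff_contDiffAt.2 fun s => (analyticAt_mgf (hset s)).contDiffAt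
  have hneg : ContDiff ℝ k (fun s => mgf X μ (-s)) := hmgf.comp contDiff_neg
  rw [hcosh]
  refine ⟨contDiff_const.mul (hmgf.add hneg), fun s => ?_⟩
  rw [iteratedDeriv_const_mul_field,
    iteratedDeriv_fun_add hmgf.contDiffAt hneg.contDiffAt, iteratedDeriv_comp_neg,
    iteratedDeriv_mgf (hset s), iteratedDeriv_mgf (hset (-s)), smul_eq_mul,
    ← integral_const_mul, ← integral_add, ← integral_const_mul]
  · congr 1; funext ω; ring
  · exact integrable_pow_mul_exp_of_mem_interior_integrableExpSet (hset s) k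
  · exact (integrable_pow_mul_exp_of_mem_interior_integrableExpSet (hset (-s)) k).const_mul _

lemma K0_nonneg (x : ℝ) : 0 ≤ K0 x :=
  setIntegral_nonneg measurableSet_Ioi fun _ _ => (Real.exp_pos _).le

lemma measurable_K0 : Measurable K0 := by
  have h : Continuous (Function.uncurry fun x t : ℝ => Real.exp (-x * Real.cosh t)) := by
    unfold Function.uncurry; fun_prop
  exact (StronglyMeasurable.integral_prod_right (ν := volume.restrict (Ioi (0 : ℝ)))
    h.stronglyMeasurable).measurable

lemma exp_neg_mul_cosh_le {x : ℝ} (hx : 0 < x) (t : ℝ) :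
    Real.exp (-x * Real.cosh t) ≤ (x / 2) ^ (-(1 / 2) : ℝ) * Real.exp (-(1 / 2) * t) := by
  rw [Real.rpow_def_of_pos (by positivity), ← Real.exp_add, Real.exp_le_exp]
  have h1 : Real.exp t / 2 ≤ Real.cosh t := by
    rw [Real.cosh_eq]; linarith [Real.exp_pos (-t)]
  have h2 : Real.log (x / 2) + t ≤ x / 2 * Real.exp t := by
    have := Real.log_le_self (x := x / 2 * Real.exp t) (by positivity)
    rwa [Real.log_mul (by positivity) (by positivity), Real.log_exp] at this
  have h3 : 0 ≤ x / 2 * Real.exp t := by positivity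
  nlinarith [mul_le_mul_of_nonneg_left h1 hx.le]

lemma integrableOn_exp_neg_half_mul :
    IntegrableOn (fun t : ℝ => Real.exp (-(1 / 2) * t)) (Ioi 0) :=
  exp_neg_integrableOn_Ioi 0 (by norm_num)

lemma integrableOn_exp_neg_mul_cosh {x : ℝ} (hx : 0 < x) :
    IntegrableOn (fun t : ℝ => Real.exp (-x * Real.cosh t)) (Ioi 0) := by
  refine Integrable.mono' (integrableOn_exp_neg_half_mul.const_mul ((x / 2) ^ (-(1 / 2) : ℝ)))
    (by fun_prop) (ae_of_all _ fun t => ?_)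
  rw [Real.norm_of_nonneg (Real.exp_pos _).le]
  exact exp_neg_mul_cosh_le hx t

lemma K0_le_rpow {x : ℝ} (hx : 0 < x) : K0 x ≤ 2 * (x / 2) ^ (-(1 / 2) : ℝ) := by
  have h := integral_mono (integrableOn_exp_neg_mul_cosh hx)
    (integrableOn_exp_neg_half_mul.const_mul ((x / 2) ^ (-(1 / 2) : ℝ)))
    (exp_neg_mul_cosh_le hx)
  rw [integral_const_mul, integral_exp_mul_Ioi (by norm_num)] at h
  norm_num at h
  norm_num [K0] at h ⊢
  linarith

lemma K0_add_le {x y : ℝ} (hx : 0 < x) (hy : 0 ≤ y) :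
    K0 (x + y) ≤ Real.exp (-y) * K0 x := by
  unfold K0
  rw [← integral_const_mul]
  refine integral_mono (integrableOn_exp_neg_mul_cosh (by positivity))
    ((integrableOn_exp_neg_mul_cosh hx).const_mul _) fun t => ?_
  rw [← Real.exp_add, Real.exp_le_exp]
  nlinarith [Real.one_le_cosh t]

lemma K0_le_of_le {x y : ℝ} (hx : 0 < x) (hxy : x ≤ y) :
    K0 y ≤ Real.exp (x - y) * K0 x := by
  have := K0_add_le hx (sub_nonneg.2 hxy)
  simpa using this

lemma K0_anti {x y : ℝ} (hx : 0 < x) (hxy : x ≤ y) : K0 y ≤ K0 x :=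
  (K0_le_of_le hx hxy).trans
    (mul_le_of_le_one_left (K0_nonneg x) (Real.exp_le_one_iff.2 (by linarith)))

lemma sq_div_four_le_sinh {t : ℝ} (ht : 0 ≤ t) : t ^ 2 / 4 ≤ Real.sinh t := by
  rw [Real.sinh_eq]
  have h1 := Real.quadratic_le_exp_of_nonneg ht
  have h2 : Real.exp (-t) ≤ 1 := Real.exp_le_one_iff.2 (by linarith)
  linarith

lemma integrableOn_K0_sinh_mul_exp {z : ℝ} (hz : 0 < z) (s : ℝ) :
    IntegrableOn (fun t => K0 (2 * z * Real.sinh t) * Real.exp (s * t)) (Ioi 0) := by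
  have hG := (Real.GammaIntegral_convergent (s := 1 / 2) (by norm_num)).const_mul
    (2 * (z / 2) ^ (-(1 / 2) : ℝ) * Real.exp ((s + 1) ^ 2 / z))
  have hmeas : Measurable (fun t => K0 (2 * z * Real.sinh t) * Real.exp (s * t)) :=
    (measurable_K0.comp (by fun_prop)).mul (by fun_prop)
  refine Integrable.mono' hG hmeas.aestronglyMeasurable
    ((ae_restrict_iff' measurableSet_Ioi).2 (ae_of_all _ fun t (ht : 0 < t) => ?_))
  rw [Real.norm_of_nonneg (mul_nonneg (K0_nonneg _) (Real.exp_pos _).le)]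
  have hsinh : t ≤ Real.sinh t := Real.self_le_sinh_iff.2 ht.le
  have hS : 0 < z * Real.sinh t := mul_pos hz (ht.trans_le hsinh)
  have h1 : K0 (2 * z * Real.sinh t) ≤
      Real.exp (-(z * Real.sinh t)) * (2 * (z / 2 * t) ^ (-(1 / 2) : ℝ)) := by
    have ha := K0_add_le hS hS.le
    rw [← two_mul, ← mul_assoc] at ha
    refine ha.trans (mul_le_mul_of_nonneg_left ((K0_le_rpow hS).trans ?_) (Real.exp_pos _).le)
    refine mul_le_mul_of_nonneg_left ?_ (by norm_num)
    refine Real.rpow_le_rpow_of_nonpos (by positivity) ?_ (by norm_num)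
    nlinarith
  have h2 : Real.exp (-(z * Real.sinh t)) * Real.exp (s * t) ≤
      Real.exp ((s + 1) ^ 2 / z) * Real.exp (-t) := by
    rw [← Real.exp_add, ← Real.exp_add, Real.exp_le_exp]
    have hq := mul_le_mul_of_nonneg_left (sq_div_four_le_sinh ht.le) hz.le
    have hsq : (s + 1) * t ≤ (s + 1) ^ 2 / z + z * (t ^ 2 / 4) := by
      have : (s + 1) ^ 2 / z + z * (t ^ 2 / 4) - (s + 1) * t =
          ((s + 1) - z * t / 2) ^ 2 / z := by field_simp; ring
      have : 0 ≤ ((s + 1) - z * t / 2) ^ 2 / z := by positivity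
      linarith
    linarith
  rw [Real.mul_rpow (by positivity) ht.le] at h1
  calc K0 (2 * z * Real.sinh t) * Real.exp (s * t)
      ≤ Real.exp (-(z * Real.sinh t)) *
          (2 * ((z / 2) ^ (-(1 / 2) : ℝ) * t ^ (-(1 / 2) : ℝ))) * Real.exp (s * t) :=
        mul_le_mul_of_nonneg_right h1 (Real.exp_pos _).le
    _ = (2 * ((z / 2) ^ (-(1 / 2) : ℝ) * t ^ (-(1 / 2) : ℝ))) *
          (Real.exp (-(z * Real.sinh t)) * Real.exp (s * t)) := by ring
    _ ≤ (2 * ((z / 2) ^ (-(1 / 2) : ℝ) * t ^ (-(1 / 2) : ℝ))) *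
          (Real.exp ((s + 1) ^ 2 / z) * Real.exp (-t)) :=
        mul_le_mul_of_nonneg_left h2 (by positivity)
    _ = _ := by
        rw [show (1 / 2 - 1 : ℝ) = -(1 / 2) by norm_num]; ring

/-- The measure `K₀(2z sinh t) dt` on `(0, ∞)`. -/
noncomputable def nicholsonMeasure (z : ℝ) : Measure ℝ :=
  (volume.restrict (Ioi 0)).withDensity fun t => ((K0 (2 * z * Real.sinh t)).toNNReal : ENNReal)

lemma measurable_toNNReal_K0_sinh (z : ℝ) :
    Measurable fun t => (K0 (2 * z * Real.sinh t)).toNNReal :=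
  (measurable_K0.comp (by fun_prop)).real_toNNReal

lemma integral_nicholsonMeasure (z : ℝ) (g : ℝ → ℝ) :
    ∫ t, g t ∂nicholsonMeasure z = ∫ t in Ioi (0:ℝ), K0 (2 * z * Real.sinh t) * g t := by
  rw [nicholsonMeasure, integral_withDensity_eq_integral_smul (measurable_toNNReal_K0_sinh z)]
  simp only [NNReal.smul_def, smul_eq_mul, Real.coe_toNNReal _ (K0_nonneg _)]

lemma integrable_nicholsonMeasure_iff (z : ℝ) (g : ℝ → ℝ) :
    Integrable g (nicholsonMeasure z) ↔
      IntegrableOn (fun t => K0 (2 * z * Real.sinh t) * g t) (Ioi 0) := by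
  rw [nicholsonMeasure,
    integrable_withDensity_iff_integrable_coe_smul (measurable_toNNReal_K0_sinh z)]
  simp only [smul_eq_mul, Real.coe_toNNReal _ (K0_nonneg _), IntegrableOn]

lemma integrable_exp_nicholsonMeasure {z : ℝ} (hz : 0 < z) (s : ℝ) :
    Integrable (fun t => Real.exp (s * t)) (nicholsonMeasure z) :=
  (integrable_nicholsonMeasure_iff z _).2 (integrableOn_K0_sinh_mul_exp hz s)

lemma integrable_exp_two_mul_nicholsonMeasure {z : ℝ} (hz : 0 < z) (s : ℝ) :
    Integrable (fun t => Real.exp (s * (2 * t))) (nicholsonMeasure z) := by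
  simpa only [mul_assoc] using integrable_exp_nicholsonMeasure hz (s * 2)

open ProbabilityTheory in
lemma integrable_pow_mul_exp_nicholsonMeasure {z : ℝ} (hz : 0 < z) (k : ℕ) (s : ℝ) :
    Integrable (fun t => t ^ k * Real.exp (s * t)) (nicholsonMeasure z) := by
  have huniv : integrableExpSet (fun t : ℝ => t) (nicholsonMeasure z) = univ :=
    eq_univ_of_forall (integrable_exp_nicholsonMeasure hz)
  exact integrable_pow_mul_exp_of_mem_interior_integrableExpSet (X := fun t : ℝ => t)
    (by simp [huniv]) k

lemma integrableOn_K0_sinh_mul_pow_mul_exp {z : ℝ} (hz : 0 < z) (k : ℕ) (s : ℝ) :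
    IntegrableOn (fun t => K0 (2 * z * Real.sinh t) * (t ^ k * Real.exp (s * t))) (Ioi 0) :=
  (integrable_nicholsonMeasure_iff z _).1 (integrable_pow_mul_exp_nicholsonMeasure hz k s)

lemma integrableOn_K0_sinh_mul_pow_mul_cosh {z : ℝ} (hz : 0 < z) (k : ℕ) (ν : ℝ) :
    IntegrableOn (fun t => K0 (2 * z * Real.sinh t) * (t ^ k * Real.cosh (2 * ν * t)))
      (Ioi 0) := by
  refine (((integrableOn_K0_sinh_mul_pow_mul_exp hz k (2 * ν)).add
    (integrableOn_K0_sinh_mul_pow_mul_exp hz k (-(2 * ν)))).div_const 2).congr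
      (ae_of_all _ fun t => ?_)
  simp only [Pi.add_apply, Real.cosh_eq, neg_mul]
  ring

lemma integrableOn_K0_sinh_mul_cosh {z : ℝ} (hz : 0 < z) (ν : ℝ) :
    IntegrableOn (fun t => K0 (2 * z * Real.sinh t) * Real.cosh (2 * ν * t)) (Ioi 0) := by
  simpa using integrableOn_K0_sinh_mul_pow_mul_cosh hz 0 ν

lemma exists_K0_sinh_tail_bound (k : ℕ) :
    ∃ D : ℝ, 0 ≤ D ∧ ∀ ν z t : ℝ, 2 ≤ ν → 0 < z → z ≤ 1 → 2 * (ν + |Real.log z|) ≤ t →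
      K0 (2 * z * Real.sinh t) * (t ^ k * Real.cosh (2 * ν * t)) ≤
        D * K0 (2 * z * Real.sinh 1) * Real.exp (-t) := by
  refine ⟨k.factorial * Real.exp (2 * Real.sinh 1 + 50000), by positivity, ?_⟩
  intro ν z t hν hz hz1 ht
  have hL := abs_nonneg (Real.log z)
  have ht4 : 4 ≤ t := by linarith
  have hsinh1 : 0 < Real.sinh 1 := Real.sinh_pos_iff.2 one_pos
  have hK : K0 (2 * z * Real.sinh t) ≤
      Real.exp (2 * z * Real.sinh 1 - 2 * z * Real.sinh t) * K0 (2 * z * Real.sinh 1) :=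
    K0_le_of_le (by positivity)
      (mul_le_mul_of_nonneg_left (Real.sinh_le_sinh.2 (by linarith)) (by positivity))
  have hpow : t ^ k ≤ k.factorial * Real.exp t := by
    have := Real.pow_div_factorial_le_exp (x := t) (by linarith) k
    rwa [div_le_iff₀' (by positivity)] at this
  have hcosh : Real.cosh (2 * ν * t) ≤ Real.exp (t ^ 2) := by
    have h0 : Real.cosh (2 * ν * t) ≤ Real.exp (2 * ν * t) := by
      have : Real.exp (-(2 * ν * t)) ≤ Real.exp (2 * ν * t) :=
        Real.exp_le_exp.2 (by nlinarith)
      rw [Real.cosh_eq]; linarith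
    exact h0.trans (Real.exp_le_exp.2 (by nlinarith))
  have hz_ge : Real.exp (-(t / 2)) ≤ z := by
    rw [← Real.le_log_iff_exp_le hz]
    linarith [neg_abs_le (Real.log z)]
  have hsinh_ge : Real.exp t / 4 ≤ Real.sinh t := by
    rw [Real.sinh_eq]
    have h1 : Real.exp (-t) ≤ 1 := Real.exp_le_one_iff.2 (by linarith)
    linarith [Real.add_one_le_exp t]
  have hcube : t ^ 3 / 96 ≤ 2 * z * Real.sinh t := by
    have h1 : (t / 2) ^ 3 / 6 ≤ Real.exp (t / 2) := by
      simpa [Nat.factorial] using Real.pow_div_factorial_le_exp (x := t / 2) (by linarith) 3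
    have h2 : Real.exp (-(t / 2)) * (Real.exp t / 4) ≤ z * Real.sinh t :=
      mul_le_mul hz_ge hsinh_ge (by positivity) hz.le
    have h3 : Real.exp (-(t / 2)) * (Real.exp t / 4) = Real.exp (t / 2) / 4 := by
      rw [← mul_div_assoc, ← Real.exp_add]; ring_nf
    rw [h3] at h2
    nlinarith
  have hpoly : t ^ 2 + 2 * t ≤ 50000 + t ^ 3 / 96 := by
    rcases le_total t 200 with h | h
    · have : 0 ≤ t ^ 3 := by positivity
      nlinarith
    · have : 0 ≤ t ^ 2 * (t - 200) := mul_nonneg (sq_nonneg t) (by linarith)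
      nlinarith
  have hexp : Real.exp (2 * z * Real.sinh 1 - 2 * z * Real.sinh t) *
      (Real.exp t * Real.exp (t ^ 2)) ≤
      Real.exp (2 * Real.sinh 1 + 50000) * Real.exp (-t) := by
    rw [← Real.exp_add, ← Real.exp_add, ← Real.exp_add, Real.exp_le_exp]
    nlinarith
  calc K0 (2 * z * Real.sinh t) * (t ^ k * Real.cosh (2 * ν * t))
      ≤ (Real.exp (2 * z * Real.sinh 1 - 2 * z * Real.sinh t) * K0 (2 * z * Real.sinh 1)) *
          ((k.factorial * Real.exp t) * Real.exp (t ^ 2)) := by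
        refine mul_le_mul hK (mul_le_mul hpow hcosh (Real.cosh_pos _).le (by positivity)) ?_
          (mul_nonneg (Real.exp_pos _).le (K0_nonneg _))
        exact mul_nonneg (pow_nonneg (by linarith) k) (Real.cosh_pos _).le
    _ = (k.factorial * K0 (2 * z * Real.sinh 1)) *
          (Real.exp (2 * z * Real.sinh 1 - 2 * z * Real.sinh t) *
            (Real.exp t * Real.exp (t ^ 2))) := by ring
    _ ≤ (k.factorial * K0 (2 * z * Real.sinh 1)) *
          (Real.exp (2 * Real.sinh 1 + 50000) * Real.exp (-t)) :=
        mul_le_mul_of_nonneg_left hexp (mul_nonneg (by positivity) (K0_nonneg _))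
    _ = _ := by ring

lemma K0_sinh_one_le_integral {z : ℝ} (hz : 0 < z) (ν : ℝ) :
    K0 (2 * z * Real.sinh 1) ≤
      ∫ t in Ioi (0:ℝ), K0 (2 * z * Real.sinh t) * Real.cosh (2 * ν * t) := by
  have hint := integrableOn_K0_sinh_mul_cosh hz ν
  have hsub : Ioc (0:ℝ) 1 ⊆ Ioi 0 := Ioc_subset_Ioi_self
  calc K0 (2 * z * Real.sinh 1) = ∫ _ in Ioc (0:ℝ) 1, K0 (2 * z * Real.sinh 1) := by simp
    _ ≤ ∫ t in Ioc (0:ℝ) 1, K0 (2 * z * Real.sinh t) * Real.cosh (2 * ν * t) := by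
        refine setIntegral_mono_on (by simp) (hint.mono_set hsub) measurableSet_Ioc
          fun t ht => ?_
        have hpos : 0 < 2 * z * Real.sinh t :=
          mul_pos (by positivity) (Real.sinh_pos_iff.2 ht.1)
        refine (K0_anti hpos (mul_le_mul_of_nonneg_left (Real.sinh_le_sinh.2 ht.2)
          (by positivity))).trans ?_
        exact le_mul_of_one_le_right (K0_nonneg _) (Real.one_le_cosh _)
    _ ≤ _ := setIntegral_mono_set hint
        (ae_of_all _ fun t => mul_nonneg (K0_nonneg _) (Real.cosh_pos _).le)
        hsub.eventuallyLE

lemma exists_integral_pow_mul_cosh_le (k : ℕ) :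
    ∃ D : ℝ, 0 < D ∧ ∀ ν z : ℝ, 2 ≤ ν → 0 < z → z ≤ 1 →
      ∫ t in Ioi (0:ℝ), K0 (2 * z * Real.sinh t) * (t ^ k * Real.cosh (2 * ν * t)) ≤
        D * (ν + |Real.log z|) ^ k *
          ∫ t in Ioi (0:ℝ), K0 (2 * z * Real.sinh t) * Real.cosh (2 * ν * t) := by
  obtain ⟨D, hD, htail⟩ := exists_K0_sinh_tail_bound k
  refine ⟨2 ^ k + D, by positivity, fun ν z hν hz hz1 => ?_⟩
  set N := ν + |Real.log z| with hN
  set I := ∫ t in Ioi (0:ℝ), K0 (2 * z * Real.sinh t) * Real.cosh (2 * ν * t) with hI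
  have hN1 : 1 ≤ N := by linarith [abs_nonneg (Real.log z)]
  have hexp : IntegrableOn (fun t : ℝ => Real.exp (-t)) (Ioi 0) := integrableOn_exp_neg_Ioi 0
  have hmain := (integrableOn_K0_sinh_mul_cosh hz ν).const_mul ((2 * N) ^ k)
  have hrest := hexp.const_mul (D * K0 (2 * z * Real.sinh 1))
  have hle : K0 (2 * z * Real.sinh 1) ≤ I := K0_sinh_one_le_integral hz ν
  have hI0 : 0 ≤ I := (K0_nonneg _).trans hle
  calc ∫ t in Ioi (0:ℝ), K0 (2 * z * Real.sinh t) * (t ^ k * Real.cosh (2 * ν * t))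
      ≤ ∫ t in Ioi (0:ℝ), ((2 * N) ^ k * (K0 (2 * z * Real.sinh t) * Real.cosh (2 * ν * t)) +
          D * K0 (2 * z * Real.sinh 1) * Real.exp (-t)) := by
        refine setIntegral_mono_on (integrableOn_K0_sinh_mul_pow_mul_cosh hz k ν)
          (hmain.add hrest) measurableSet_Ioi fun t (ht : 0 < t) => ?_
        have hw : 0 ≤ K0 (2 * z * Real.sinh t) * Real.cosh (2 * ν * t) :=
          mul_nonneg (K0_nonneg _) (Real.cosh_pos _).le
        rcases le_total t (2 * N) with h | h
        · have h1 := mul_le_mul_of_nonneg_right (pow_le_pow_left₀ ht.le h k) hw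
          have h2 : 0 ≤ D * K0 (2 * z * Real.sinh 1) * Real.exp (-t) :=
            mul_nonneg (mul_nonneg hD (K0_nonneg _)) (Real.exp_pos _).le
          linarith
        · have h1 := htail ν z t hν hz hz1 h
          have h2 : 0 ≤ (2 * N) ^ k * (K0 (2 * z * Real.sinh t) * Real.cosh (2 * ν * t)) :=
            mul_nonneg (by positivity) hw
          linarith
    _ = (2 * N) ^ k * I + D * K0 (2 * z * Real.sinh 1) := by
        rw [integral_add hmain hrest, integral_const_mul, integral_const_mul,
          integral_exp_neg_Ioi_zero, mul_one]
    _ ≤ (2 * N) ^ k * I + D * (N ^ k * I) := by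
        have h1 : I ≤ N ^ k * I := le_mul_of_one_le_left hI0 (one_le_pow₀ hN1)
        have := mul_le_mul_of_nonneg_left (hle.trans h1) hD
        linarith
    _ = _ := by rw [mul_pow]; ring

/-- For each `k` there is `C_k > 0` such that for all `ν ≥ 2` and `0 < z ≤ 1`,
`ν ↦ M²(ν,z)` is `k` times differentiable and
`0 ≤ (∂/∂ν)^k M²(ν,z) ≤ C_k (ν + |log z|)^k M²(ν,z)`. -/
theorem nu_derivs_of_M2_bound (k : ℕ) :
    ∃ C : ℝ, 0 < C ∧ ∀ ν z : ℝ, 2 ≤ ν → 0 < z → z ≤ 1 →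
      ContDiffAt ℝ k (fun ν' => M2 ν' z) ν ∧
      0 ≤ iteratedDeriv k (fun ν' => M2 ν' z) ν ∧
      iteratedDeriv k (fun ν' => M2 ν' z) ν ≤ C * (ν + |Real.log z|) ^ k * M2 ν z := by
  obtain ⟨D, hD, hbound⟩ := exists_integral_pow_mul_cosh_le k
  refine ⟨2 ^ k * D, by positivity, fun ν z hν hz hz1 => ?_⟩
  have hM2 : (fun ν' => M2 ν' z) = fun ν' =>
      (8 / π ^ 2) * ∫ t, Real.cosh (ν' * (2 * t)) ∂nicholsonMeasure z := by
    funext ν'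
    rw [M2, integral_nicholsonMeasure]
    simp only [mul_comm 2 ν', mul_assoc]
  obtain ⟨hsmooth, hderiv⟩ :=
    contDiff_integral_cosh (integrable_exp_two_mul_nicholsonMeasure hz) k
  have hiter : iteratedDeriv k (fun ν' => M2 ν' z) ν = (8 / π ^ 2) *
      ∫ t in Ioi (0:ℝ), K0 (2 * z * Real.sinh t) * ((2 * t) ^ k *
        ((Real.exp (ν * (2 * t)) + (-1) ^ k * Real.exp (-ν * (2 * t))) / 2)) := by
    rw [hM2, iteratedDeriv_const_mul_field, hderiv, integral_nicholsonMeasure]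
  have hsign : ∀ x : ℝ, 0 ≤ x → -x ≤ (-1) ^ k * x ∧ (-1) ^ k * x ≤ x := fun x hx => by
    rcases neg_one_pow_eq_or ℝ k with h | h <;> rw [h] <;> constructor <;> linarith
  refine ⟨?_, ?_, ?_⟩
  · rw [hM2]
    exact (contDiff_const.mul hsmooth).contDiffAt
  · rw [hiter]
    refine mul_nonneg (by positivity) (setIntegral_nonneg measurableSet_Ioi
      fun t (ht : 0 < t) => mul_nonneg (K0_nonneg _) (mul_nonneg (by positivity) ?_))
    have h1 := (hsign _ (Real.exp_pos (-ν * (2 * t))).le).1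
    have h2 : Real.exp (-ν * (2 * t)) ≤ Real.exp (ν * (2 * t)) :=
      Real.exp_le_exp.2 (by nlinarith)
    linarith
  · have hle : ∫ t in Ioi (0:ℝ), K0 (2 * z * Real.sinh t) * ((2 * t) ^ k *
        ((Real.exp (ν * (2 * t)) + (-1) ^ k * Real.exp (-ν * (2 * t))) / 2)) ≤
        ∫ t in Ioi (0:ℝ),
          2 ^ k * (K0 (2 * z * Real.sinh t) * (t ^ k * Real.cosh (2 * ν * t))) := by
      have hpoint : ∀ t ∈ Ioi (0:ℝ), K0 (2 * z * Real.sinh t) * ((2 * t) ^ k *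
          ((Real.exp (ν * (2 * t)) + (-1) ^ k * Real.exp (-ν * (2 * t))) / 2)) ≤
          2 ^ k * (K0 (2 * z * Real.sinh t) * (t ^ k * Real.cosh (2 * ν * t))) := by
        intro t (ht : 0 < t)
        have h1 := (hsign _ (Real.exp_pos (-ν * (2 * t))).le).2
        have h2 : Real.cosh (2 * ν * t) =
            (Real.exp (ν * (2 * t)) + Real.exp (-ν * (2 * t))) / 2 := by
          rw [Real.cosh_eq]; ring_nf
        rw [mul_left_comm (2 ^ k), ← mul_assoc (2 ^ k), ← mul_pow, h2]
        exact mul_le_mul_of_nonneg_left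
          (mul_le_mul_of_nonneg_left (by linarith) (by positivity)) (K0_nonneg _)
      refine setIntegral_mono_on ?_
        ((integrableOn_K0_sinh_mul_pow_mul_cosh hz k ν).const_mul _) measurableSet_Ioi hpoint
      refine (((integrableOn_K0_sinh_mul_pow_mul_exp hz k (2 * ν)).add
        ((integrableOn_K0_sinh_mul_pow_mul_exp hz k (-(2 * ν))).const_mul ((-1) ^ k))).const_mul
          (2 ^ k / 2)).congr (ae_of_all _ fun t => ?_)
      simp only [Pi.add_apply, mul_pow]
      rw [show ν * (2 * t) = 2 * ν * t by ring, show -ν * (2 * t) = -(2 * ν) * t by ring]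
      ring
    rw [hiter, M2]
    rw [integral_const_mul] at hle
    calc _ ≤ (8 / π ^ 2) * (2 ^ k * (D * (ν + |Real.log z|) ^ k *
          ∫ t in Ioi (0:ℝ), K0 (2 * z * Real.sinh t) * Real.cosh (2 * ν * t))) :=
          mul_le_mul_of_nonneg_left (hle.trans
            (mul_le_mul_of_nonneg_left (hbound ν z hν hz hz1) (by positivity))) (by positivity)
      _ = _ := by ring
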